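/- arXiv:2602.03436 — 2 statements merged into one kernel-verified Lean document; each statement's English description precedes it below -/
import Mathlib

section
/- Let φ be a (3,4)-CNF formula with m > 10 clauses and n > 10 variables. Then each of the rooted trees ξ_1, …, ξ_m is a maximal 2-frequent tree of 𝒯_φ = {ξ, ξ_1, …, ξ_m, Γ_φ}; in particular, no ξ_j is subtree isomorphic to Γ_φ. -/
/-- A rooted unordered tree: a root together with a (finite) list of child subtrees.
Since all tree notions below are invariant under permuting children, this represents
unordered trees. -/
inductive RTree : Type where
  | node : List RTree → RTree

namespace RTree

/-- The children of the root. -/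
def children : RTree → List RTree
  | node cs => cs

/-- The height of a rooted tree: the maximum length of a root-to-vertex path. -/
def height : RTree → ℕ
  | node [] => 0
  | node (c :: cs) => max (height c + 1) (height (node cs))

/-- `Emb T₁ T₂` means `T₁` is subtree isomorphic to `T₂` (written `T₁ ≼ T₂`):
some sub-multiset of the root's children of `T₂` matches the children of the root of
`T₁`, each child of `T₁` embedding into the matched child of `T₂`. -/
inductive Emb : RTree → RTree → Prop where
  | node {cs₁ cs₂ l : List RTree} :
      List.Forall₂ Emb cs₁ l → l.Subperm cs₂ → Emb (node cs₁) (node cs₂)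

/-- Isomorphism of rooted unordered trees: mutual subtree isomorphism. -/
def Iso (T₁ T₂ : RTree) : Prop := Emb T₁ T₂ ∧ Emb T₂ T₁

/-- For a rooted tree `T` (of height 2), `chi T` is the multiset
`{|ch(v)| + 1 : v ∈ ch(r(T))}`. -/
def chi (T : RTree) : Multiset ℕ :=
  ((T.children.map (fun c => c.children.length + 1) : List ℕ) : Multiset ℕ)

end RTree

namespace RTree

/-- The height-`0` tree (a single leaf). -/
def leafT : RTree := .node []

/-- The star with `k` leaf children. -/
def starT (k : ℕ) : RTree := .node (List.replicate k leafT)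

/-- The gadget tree `ν^m_j`: a height-`2` tree whose root has `m − j + 1` children,
each with exactly `j` leaf children. -/
def nu (m j : ℕ) : RTree := .node (List.replicate (m - j + 1) (starT j))

/-- The gadget tree `ζ`: its root has `m` children `w₁, …, w_m`, the subtree rooted at
`w_i` being `ν^m_i`. -/
def zeta (m : ℕ) : RTree := .node ((List.range m).map (fun i => nu m (i + 1)))

/-- The gadget tree `ζ_j`: `ζ` with the child subtree `ν^m_j` removed. -/
def zetaDel (m j : ℕ) : RTree :=
  .node (((List.range m).filter (fun i => i + 1 != j)).map (fun i => nu m (i + 1)))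

end RTree

/-- A clause of a CNF formula: a list of literals, a literal being a pair `(i, b)`
meaning `x_i` if `b = true` and `¬x_i` if `b = false`. -/
abbrev Clause := List (ℕ × Bool)

/-- The (0-indexed) list of indices of clauses containing the literal `(i, b)`. -/
def litClauses (cs : List Clause) (i : ℕ) (b : Bool) : List ℕ :=
  (List.range cs.length).filter (fun j => decide ((i, b) ∈ cs.getD j []))

/-- `cs` is a (3,4)-CNF formula over variables `x₁, …, x_n`: every clause has at most
three literals (over those variables) and each literal appears in at most four
clauses. -/
def IsCNF34 (n : ℕ) (cs : List Clause) : Prop :=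
  (∀ C ∈ cs, (∀ l ∈ C, 1 ≤ l.1 ∧ l.1 ≤ n) ∧ C.length ≤ 3) ∧
  (∀ i b, (litClauses cs i b).length ≤ 4)

namespace RTree

/-- The tree whose root's children are the trees `ν^m_{j+1}` for `j` in the list `js`. -/
def litNode (m : ℕ) (js : List ℕ) : RTree := .node (js.map (fun j => nu m (j + 1)))

/-- The gadget tree `μ_i`: its root has two children `u¹_i` and `u²_i`; `u¹_i` has a
child subtree `ν^m_j` for each clause `C_j` containing the literal `x_i`, and `u²_i`
one for each clause containing `¬x_i`. -/
def muT (cs : List Clause) (i : ℕ) : RTree :=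
  .node [litNode cs.length (litClauses cs i true), litNode cs.length (litClauses cs i false)]

/-- The gadget tree `ξ`: a height-`5` tree whose root has `n` children, each having
exactly one child that roots a copy of `ζ`. -/
def xiT (m n : ℕ) : RTree := .node (List.replicate n (.node [zeta m]))

/-- The gadget tree `ξ_j`: its root has `n` children, each having exactly one child
that roots a copy of `ζ_j`. -/
def xiJ (m n j : ℕ) : RTree := .node (List.replicate n (.node [zetaDel m j]))

/-- The gadget tree `Γ_φ`: a height-`5` tree whose root has `n` children, the `i`-th
of which roots a copy of `μ_i`. -/
def gammaT (n : ℕ) (cs : List Clause) : RTree :=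
  .node ((List.range n).map (fun i => muT cs (i + 1)))

/-- The multiset `𝒯_φ = {ξ, ξ₁, …, ξ_m, Γ_φ}`. -/
def TFam (n : ℕ) (cs : List Clause) : Multiset RTree :=
  xiT cs.length n ::ₘ gammaT n cs ::ₘ
    (((List.range cs.length).map (fun j => xiJ cs.length n (j + 1)) : List RTree) : Multiset RTree)

open Classical in
/-- The support of `T` in `𝒯`: the number of members of `𝒯` containing `T` as a
subtree. -/
noncomputable def support (𝒯 : Multiset RTree) (T : RTree) : ℕ :=
  (𝒯.filter (fun R => Emb T R)).card

/-- `T` is a maximal `θ`-frequent tree of `𝒯`: its support is at least `θ` and there is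
no `θ`-frequent tree `T'` with `T ≼ T'` and `T ≇ T'`. -/
def MaxFrequent (𝒯 : Multiset RTree) (θ : ℕ) (T : RTree) : Prop :=
  θ ≤ support 𝒯 T ∧ ∀ T' : RTree, θ ≤ support 𝒯 T' → Emb T T' → Iso T T'

end RTree

/-- The assignment `α` satisfies the clause `C`. -/
def SatClause (α : ℕ → Bool) (C : Clause) : Prop := ∃ l ∈ C, α l.1 = l.2

/-- The assignment `α` is a satisfying assignment of the CNF formula `cs`. -/
def Sat (α : ℕ → Bool) (cs : List Clause) : Prop := ∀ C ∈ cs, SatClause α C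

namespace RTree

/-- `μ_i` after applying the assignment `α`: the subtree rooted at `u¹_i` is deleted if
`α(x_i) = true`, and the subtree rooted at `u²_i` is deleted otherwise. -/
def muA (cs : List Clause) (α : ℕ → Bool) (i : ℕ) : RTree :=
  .node [if α i then litNode cs.length (litClauses cs i false)
         else litNode cs.length (litClauses cs i true)]

/-- The gadget tree `Γ_α`: obtained from `Γ_φ` by deleting, for each `i`, the subtree
rooted at `u¹_i` if `α(x_i) = true` and the subtree rooted at `u²_i` otherwise. -/
def gammaA (n : ℕ) (cs : List Clause) (α : ℕ → Bool) : RTree :=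
  .node ((List.range n).map (fun i => muA cs α (i + 1)))

end RTree

namespace RTree

theorem emb_inv {as bs : List RTree} (h : Emb (node as) (node bs)) :
    ∃ l, List.Forall₂ Emb as l ∧ l.Subperm bs := by
  cases h with
  | node h1 h2 => exact ⟨_, h1, h2⟩

theorem sublist_push {R : RTree → RTree → Prop} {l bs : List RTree} (h : l.Sublist bs) :
    ∀ {l' : List RTree}, List.Forall₂ R bs l' → ∃ l'', l''.Sublist l' ∧ List.Forall₂ R l l'' := by
  induction h with
  | slnil => intro l' h; exact ⟨l', List.Sublist.refl _, h⟩
  | cons a _ ih =>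
    intro l' h
    cases h with
    | cons h1 h2 =>
      obtain ⟨t, ht, hr⟩ := ih h2
      exact ⟨t, ht.cons _, hr⟩
  | cons_cons a _ ih =>
    intro l' h
    cases h with
    | cons h1 h2 =>
      obtain ⟨t, ht, hr⟩ := ih h2
      exact ⟨_, ht.cons_cons _, List.Forall₂.cons h1 hr⟩

theorem perm_push {R : RTree → RTree → Prop} {l p : List RTree} (h : l.Perm p) :
    ∀ {q : List RTree}, List.Forall₂ R p q → ∃ l'', l''.Perm q ∧ List.Forall₂ R l l'' := by
  induction h with
  | nil => intro q h; exact ⟨q, List.Perm.refl _, h⟩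
  | cons a _ ih =>
    intro q h
    cases h with
    | cons h1 h2 =>
      obtain ⟨t, ht, hr⟩ := ih h2
      exact ⟨_, ht.cons _, List.Forall₂.cons h1 hr⟩
  | swap a b l =>
    intro q h
    cases h with
    | cons h1 h2 =>
      cases h2 with
      | cons h3 h4 =>
        exact ⟨_, List.Perm.swap _ _ _, List.Forall₂.cons h3 (List.Forall₂.cons h1 h4)⟩
  | trans _ _ ih1 ih2 =>
    intro q h
    obtain ⟨t, ht, hr⟩ := ih2 h
    obtain ⟨u, hu, hs⟩ := ih1 hr
    exact ⟨u, hu.trans ht, hs⟩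

theorem subperm_push {R : RTree → RTree → Prop} {l bs l' : List RTree} (h : l.Subperm bs)
    (h' : List.Forall₂ R bs l') : ∃ l'', l''.Subperm l' ∧ List.Forall₂ R l l'' := by
  obtain ⟨p, hp, hs⟩ := h
  obtain ⟨t, ht, hr⟩ := sublist_push hs h'
  obtain ⟨u, hu, hs⟩ := perm_push hp.symm hr
  exact ⟨u, hu.subperm.trans ht.subperm, hs⟩

theorem forall_trans {as l : List RTree} (h : List.Forall₂ Emb as l) :
    ∀ {k : List RTree}, (∀ a ∈ as, ∀ b c, Emb a b → Emb b c → Emb a c) →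
      List.Forall₂ Emb l k → List.Forall₂ Emb as k := by
  induction h with
  | nil => intro k _ h; exact h
  | cons h1 _ ih =>
    intro k H h
    cases h with
    | cons h3 h4 =>
      exact List.Forall₂.cons (H _ (by simp) _ _ h1 h3)
        (ih (fun a ha => H a (by simp [ha])) h4)

theorem emb_trans_aux (s : ℕ) : ∀ A : RTree, sizeOf A ≤ s → ∀ B C, Emb A B → Emb B C → Emb A C := by
  induction s with
  | zero =>
    intro A hA
    cases A with
    | node as => simp at hA
  | succ s ih =>
    intro A hA B C h1 h2
    cases h1 with
    | node f1 s1 =>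
      cases h2 with
      | node f2 s2 =>
        obtain ⟨t, ht, hr⟩ := subperm_push s1 f2
        refine Emb.node (forall_trans f1 ?_ hr) (ht.trans s2)
        intro a ha
        refine ih a ?_
        have := List.sizeOf_lt_of_mem ha
        simp at hA
        omega

theorem emb_trans {A B C : RTree} (h1 : Emb A B) (h2 : Emb B C) : Emb A C :=
  emb_trans_aux _ A le_rfl B C h1 h2

theorem emb_refl_aux (s : ℕ) : ∀ A : RTree, sizeOf A ≤ s → Emb A A := by
  induction s with
  | zero =>
    intro A hA
    cases A with
    | node as => simp at hA
  | succ s ih =>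
    intro A hA
    cases A with
    | node as =>
      refine Emb.node (l := as) (List.forall₂_same.2 ?_) (List.Subperm.refl _)
      intro a ha
      refine ih a ?_
      have := List.sizeOf_lt_of_mem ha
      simp at hA
      omega

theorem emb_refl (A : RTree) : Emb A A := emb_refl_aux _ A le_rfl

theorem emb_length {as bs : List RTree} (h : Emb (node as) (node bs)) : as.length ≤ bs.length := by
  obtain ⟨l, h1, h2⟩ := emb_inv h
  rw [h1.length_eq]; exact h2.length_le

theorem emb_mem {as bs : List RTree} (h : Emb (node as) (node bs)) {a : RTree} (ha : a ∈ as) :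
    ∃ b ∈ bs, Emb a b := by
  obtain ⟨l, h1, h2⟩ := emb_inv h
  obtain ⟨i, hi, rfl⟩ := List.getElem_of_mem ha
  have hi' : i < l.length := h1.length_eq ▸ hi
  exact ⟨l[i], h2.subset (List.getElem_mem hi'), h1.get hi hi'⟩

theorem emb_sublist {as bs : List RTree} (h : as.Sublist bs) : Emb (node as) (node bs) :=
  Emb.node (List.forall₂_same.2 fun a _ => emb_refl a) h.subperm

theorem nu_eq {m i k : ℕ} (hi : i ≤ m) (hk : k ≤ m) (h : Emb (nu m i) (nu m k)) : i = k := by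
  have h1 := emb_length h
  obtain ⟨b, hb, hab⟩ := emb_mem h (a := starT i) (by simp)
  have hb := (List.mem_replicate.1 hb).2
  subst hb
  have h2 := emb_length hab
  simp at h1 h2
  omega

theorem xiJ_emb_inv {m n j : ℕ} {bs : List RTree} (hn : 0 < n)
    (h : Emb (xiJ m n j) (node bs)) : ∃ b ∈ bs, Emb (node [zetaDel m j]) b :=
  emb_mem h (by simp; omega)

theorem xiJ_eq {m n j k : ℕ} (hn : 0 < n) (hk : 1 ≤ k) (hkm : k ≤ m)
    (h : Emb (xiJ m n j) (xiJ m n k)) : j = k := by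
  obtain ⟨b, hb, hab⟩ := xiJ_emb_inv hn h
  have hb := (List.mem_replicate.1 hb).2
  subst hb
  obtain ⟨c, hc, hac⟩ := emb_mem hab (a := zetaDel m j) (by simp)
  simp only [List.mem_singleton] at hc
  subst hc
  by_contra hjk
  obtain ⟨d, hd, had⟩ := emb_mem hac (a := nu m k) (by
    simp only [List.mem_map, List.mem_filter, List.mem_range, bne_iff_ne]
    exact ⟨k - 1, ⟨by omega, by omega⟩, by congr 1; omega⟩)
  simp only [List.mem_map, List.mem_filter, List.mem_range, bne_iff_ne] at hd
  obtain ⟨i, ⟨hi, hik⟩, rfl⟩ := hd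
  exact hik (nu_eq hkm (by omega) had).symm

theorem zetaDel_length (m j : ℕ) :
    m ≤ ((List.range m).filter (fun i => i + 1 != j)).length + 1 := by
  have h1 : ((List.range m).erase (j - 1)).Subperm
      ((List.range m).filter (fun i => i + 1 != j)) := by
    refine List.Nodup.subperm (List.nodup_range.erase _) ?_
    intro i hi
    rw [List.nodup_range.mem_erase_iff] at hi
    simp only [List.mem_filter, bne_iff_ne]
    exact ⟨hi.2, by omega⟩
  have h2 := h1.length_le
  rw [List.length_erase] at h2
  split at h2 <;> simp only [List.length_range] at h2 <;> omega

theorem not_emb_gamma {n : ℕ} {cs : List Clause} (hn : 10 < n) (hm : 10 < cs.length)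
    (hcnf : IsCNF34 n cs) (j : ℕ) : ¬ Emb (xiJ cs.length n j) (gammaT n cs) := by
  intro h
  obtain ⟨b, hb, hab⟩ := xiJ_emb_inv (by omega) h
  obtain ⟨i, -, rfl⟩ := List.mem_map.1 hb
  obtain ⟨c, hc, hac⟩ := emb_mem hab (a := zetaDel cs.length j) (by simp)
  have key : ∀ b, ¬ Emb (zetaDel cs.length j) (litNode cs.length (litClauses cs (i + 1) b)) := by
    intro b hb
    have h1 := emb_length hb
    rw [List.length_map, List.length_map] at h1
    have h2 := zetaDel_length cs.length j
    have h3 := hcnf.2 (i + 1) b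
    omega
  simp only [List.mem_cons, List.not_mem_nil, or_false] at hc
  rcases hc with rfl | rfl
  · exact key _ hac
  · exact key _ hac

theorem xiJ_emb_xiT (m n j : ℕ) : Emb (xiJ m n j) (xiT m n) := by
  refine Emb.node (l := List.replicate n (.node [zeta m])) ?_ (List.Subperm.refl _)
  have h : Emb (node [zetaDel m j]) (node [zeta m]) :=
    Emb.node (l := [zeta m])
      (List.Forall₂.cons (emb_sublist ((List.filter_sublist).map _)) List.Forall₂.nil)
      (List.Subperm.refl _)
  induction n with
  | zero => exact List.Forall₂.nil
  | succ n ih => exact List.Forall₂.cons h ih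

end RTree

open RTree in
/-- Let `φ` be a (3,4)-CNF formula with `m > 10` clauses and `n > 10` variables.  Then
each of `ξ₁, …, ξ_m` is a maximal `2`-frequent tree of `𝒯_φ = {ξ, ξ₁, …, ξ_m, Γ_φ}`;
in particular, no `ξ_j` is subtree isomorphic to `Γ_φ`. -/
theorem xiJ_maxFrequent (n : ℕ) (cs : List Clause)
    (hn : 10 < n) (hm : 10 < cs.length) (hcnf : IsCNF34 n cs)
    (j : ℕ) (hj1 : 1 ≤ j) (hjm : j ≤ cs.length) :
    MaxFrequent (TFam n cs) 2 (xiJ cs.length n j) ∧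
    ¬ Emb (xiJ cs.length n j) (gammaT n cs) := by
  have hG := not_emb_gamma hn hm hcnf j
  refine ⟨⟨?_, ?_⟩, hG⟩
  · classical
    unfold support TFam
    rw [Multiset.filter_cons_of_pos _ (xiJ_emb_xiT _ _ _), Multiset.card_cons,
      Multiset.filter_cons_of_neg _ hG]
    have : 0 < (Multiset.filter (fun R => Emb (xiJ cs.length n j) R)
        (((List.range cs.length).map (fun j => xiJ cs.length n (j + 1)) : List RTree) :
          Multiset RTree)).card := by
      rw [Multiset.card_pos_iff_exists_mem]
      refine ⟨xiJ cs.length n j, Multiset.mem_filter.2 ⟨?_, emb_refl _⟩⟩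
      rw [Multiset.mem_coe, List.mem_map]
      exact ⟨j - 1, List.mem_range.2 (by omega), by congr 1; omega⟩
    convert Nat.succ_le_succ this using 1
  · intro T' hT hemb
    refine ⟨hemb, ?_⟩
    classical
    have hG' : ¬ Emb T' (gammaT n cs) := fun h => hG (emb_trans hemb h)
    unfold support TFam at hT
    rw [Multiset.filter_cons, Multiset.filter_cons_of_neg _ hG', Multiset.card_add] at hT
    have h1 : (if Emb T' (xiT cs.length n) then {xiT cs.length n} else 0 :
        Multiset RTree).card ≤ 1 := by split <;> simp
    have h2 : 0 < (Multiset.filter (fun R => Emb T' R)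
        (((List.range cs.length).map (fun j => xiJ cs.length n (j + 1)) : List RTree) :
          Multiset RTree)).card := by
      by_contra h0
      have h0 := Nat.eq_zero_of_not_pos h0
      have : 2 ≤ 1 + 0 := by
        refine hT.trans (Nat.add_le_add ?_ ?_)
        · convert h1
        · rw [← h0]
      omega
    rw [Multiset.card_pos_iff_exists_mem] at h2
    obtain ⟨R, hR⟩ := h2
    obtain ⟨hR, hTR⟩ := Multiset.mem_filter.1 hR
    rw [Multiset.mem_coe, List.mem_map] at hR
    obtain ⟨k, hk, rfl⟩ := hR
    have hk := List.mem_range.1 hk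
    have := xiJ_eq (by omega) (by omega) (by omega) (emb_trans hemb hTR)
    rw [this]
    exact hTR
end

section
/- Let φ be a (3,4)-CNF formula with m > 10 clauses and n > 10 variables. If φ is satisfiable, then 𝒯_φ = {ξ, ξ_1, …, ξ_m, Γ_φ} has at least m + 1 pairwise non-isomorphic maximal 2-frequent trees. -/
namespace RTree

theorem memInd {P : RTree → Prop} (h : ∀ cs, (∀ c ∈ cs, P c) → P (node cs)) : ∀ t, P t
  | node cs => h cs (fun c _ => memInd h c)

/-- The number of vertices. -/
def numV : RTree → ℕ
  | node cs => 1 + (cs.map numV).sum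

theorem emb_iff {a b : List RTree} :
    Emb (node a) (node b) ↔ ∃ l, List.Forall₂ Emb a l ∧ l.Subperm b := by
  constructor
  · rintro ⟨h1, h2⟩
    exact ⟨_, h1, h2⟩
  · rintro ⟨l, h1, h2⟩
    exact .node h1 h2

theorem forall₂_refl_of {R : RTree → RTree → Prop} : ∀ {l : List RTree}, (∀ c ∈ l, R c c) →
    List.Forall₂ R l l
  | [], _ => .nil
  | a :: l, h => .cons (h a (by simp)) (forall₂_refl_of (fun c hc => h c (by simp [hc])))

theorem Emb.refl' (t : RTree) : Emb t t := by
  induction t using memInd with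
  | h cs ih => exact emb_iff.2 ⟨cs, forall₂_refl_of ih, List.Subperm.refl _⟩

theorem sublist_forall₂ {R : RTree → RTree → Prop} {l b : List RTree} (h : l.Sublist b) :
    ∀ {l' : List RTree}, List.Forall₂ R b l' → ∃ l'', List.Forall₂ R l l'' ∧ l''.Sublist l' := by
  induction h with
  | slnil => intro l' h; exact ⟨[], .nil, by simp⟩
  | cons a _ ih =>
    intro l' h
    cases h with
    | cons h1 h2 =>
      obtain ⟨l'', h3, h4⟩ := ih h2
      exact ⟨l'', h3, h4.cons _⟩
  | cons_cons a _ ih =>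
    intro l' h
    cases h with
    | cons h1 h2 =>
      obtain ⟨l'', h3, h4⟩ := ih h2
      exact ⟨_, .cons h1 h3, h4.cons_cons _⟩

theorem perm_forall₂ {R : RTree → RTree → Prop} {l b : List RTree} (h : l.Perm b) :
    ∀ {l' : List RTree}, List.Forall₂ R b l' → ∃ l'', List.Forall₂ R l l'' ∧ l''.Perm l' := by
  intro l' h'
  have : Relation.Comp List.Perm (List.Forall₂ R) l l' := ⟨b, h, h'⟩
  rw [← List.forall₂_comp_perm_eq_perm_comp_forall₂] at this
  exact this

theorem subperm_forall₂ {R : RTree → RTree → Prop} {l b : List RTree} (h : l.Subperm b)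
    {l' : List RTree} (h' : List.Forall₂ R b l') :
    ∃ l'', List.Forall₂ R l l'' ∧ l''.Subperm l' := by
  obtain ⟨k, hk, hs⟩ := h
  obtain ⟨l1, h1, h2⟩ := sublist_forall₂ hs h'
  obtain ⟨l2, h3, h4⟩ := perm_forall₂ hk.symm h1
  exact ⟨l2, h3, h4.subperm.trans h2.subperm⟩

theorem forall₂_comp_of {a : List RTree} (ih : ∀ c ∈ a, ∀ d e, Emb c d → Emb d e → Emb c e) :
    ∀ {b c : List RTree}, List.Forall₂ Emb a b → List.Forall₂ Emb b c → List.Forall₂ Emb a c := by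
  induction a with
  | nil => intro b c h1 h2; cases h1; exact h2
  | cons x a iha =>
    intro b c h1 h2
    cases h1 with
    | cons h3 h4 =>
      cases h2 with
      | cons h5 h6 =>
        exact .cons (ih x (by simp) _ _ h3 h5) (iha (fun c hc => ih c (by simp [hc])) h4 h6)

theorem Emb.trans' {a b c : RTree} (h1 : Emb a b) (h2 : Emb b c) : Emb a c := by
  induction a using memInd generalizing b c with
  | h cs ih =>
    obtain ⟨bs⟩ := b
    obtain ⟨ds⟩ := c
    obtain ⟨l, h3, h4⟩ := emb_iff.1 h1
    obtain ⟨k, h5, h6⟩ := emb_iff.1 h2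
    obtain ⟨q, h7, h8⟩ := subperm_forall₂ h4 h5
    exact emb_iff.2 ⟨q, forall₂_comp_of (fun c hc d e => ih c hc) h3 h7, h8.trans h6⟩

theorem emb_children {a b : List RTree} (h : Emb (node a) (node b)) :
    a.length ≤ b.length ∧ ∀ c ∈ a, ∃ d ∈ b, Emb c d := by
  obtain ⟨l, h1, h2⟩ := emb_iff.1 h
  refine ⟨h1.length_eq ▸ h2.length_le, ?_⟩
  intro c hc
  have : ∀ {a l : List RTree}, List.Forall₂ Emb a l → ∀ c ∈ a, ∃ d ∈ l, Emb c d := by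
    intro a l h
    induction h with
    | nil => simp
    | cons h _ ih =>
      intro c hc
      rcases List.mem_cons.1 hc with rfl | hc
      · exact ⟨_, by simp, h⟩
      · obtain ⟨d, hd, h⟩ := ih c hc
        exact ⟨d, by simp [hd], h⟩
  obtain ⟨d, hd, h⟩ := this h1 c hc
  exact ⟨d, h2.subset hd, h⟩

theorem numV_node (cs : List RTree) : numV (node cs) = 1 + (cs.map numV).sum := by
  rw [numV]

theorem numV_pos (t : RTree) : 0 < numV t := by
  obtain ⟨cs⟩ := t
  rw [numV_node]; omega

theorem forall₂_numV {a l : List RTree} (h : List.Forall₂ Emb a l)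
    (ih : ∀ c ∈ a, ∀ d, Emb c d → numV c ≤ numV d ∧ (numV c = numV d → Emb d c)) :
    (a.map numV).sum ≤ (l.map numV).sum ∧
    ((a.map numV).sum = (l.map numV).sum → List.Forall₂ Emb l a) := by
  induction h with
  | nil => simp
  | cons h _ ih' =>
    obtain ⟨h1, h2⟩ := ih' (fun c hc => ih c (by simp [hc]))
    obtain ⟨h3, h4⟩ := ih _ (by simp) _ h
    simp only [List.map_cons, List.sum_cons]
    refine ⟨by omega, fun h => .cons (h4 (by omega)) (h2 (by omega))⟩

theorem sublist_numV {l b : List RTree} (h : l.Sublist b) :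
    (l.map numV).sum ≤ (b.map numV).sum ∧ ((l.map numV).sum = (b.map numV).sum → l = b) := by
  induction h with
  | slnil => simp
  | cons a _ ih =>
    have := numV_pos a
    simp only [List.map_cons, List.sum_cons]
    exact ⟨by omega, fun h => by omega⟩
  | cons_cons a _ ih =>
    simp only [List.map_cons, List.sum_cons]
    exact ⟨by omega, fun h => by rw [ih.2 (by omega)]⟩

theorem subperm_numV {l b : List RTree} (h : l.Subperm b) :
    (l.map numV).sum ≤ (b.map numV).sum ∧ ((l.map numV).sum = (b.map numV).sum → l.Perm b) := by
  obtain ⟨k, hk, hs⟩ := h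
  have e : (k.map numV).sum = (l.map numV).sum := (hk.map numV).sum_eq
  have := sublist_numV hs
  rw [e] at this
  exact ⟨this.1, fun h => (this.2 h) ▸ hk.symm⟩

theorem emb_numV {a b : RTree} (h : Emb a b) :
    numV a ≤ numV b ∧ (numV a = numV b → Emb b a) := by
  induction a using memInd generalizing b with
  | h cs ih =>
    obtain ⟨bs⟩ := b
    obtain ⟨l, h1, h2⟩ := emb_iff.1 h
    have A := forall₂_numV h1 (fun c hc d => ih c hc)
    have B := subperm_numV h2
    rw [numV_node, numV_node]
    refine ⟨by omega, fun h => ?_⟩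
    obtain ⟨q, h3, h4⟩ := perm_forall₂ (B.2 (by omega)).symm (A.2 (by omega))
    exact emb_iff.2 ⟨q, h3, h4.subperm⟩

theorem emb_of_sublist {a b : List RTree} (h : a.Sublist b) : Emb (node a) (node b) :=
  emb_iff.2 ⟨a, forall₂_refl_of (fun c _ => Emb.refl' c), h.subperm⟩

theorem emb_of_forall₂ {a b : List RTree} (h : List.Forall₂ Emb a b) : Emb (node a) (node b) :=
  emb_iff.2 ⟨b, h, List.Subperm.refl _⟩

theorem emb_single {a b : RTree} (h : Emb a b) : Emb (node [a]) (node [b]) :=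
  emb_of_forall₂ (.cons h .nil)

theorem nu_inj {m a b : ℕ} (ha : a < m) (hb : b < m)
    (h : Emb (nu m (a + 1)) (nu m (b + 1))) : a = b := by
  obtain ⟨h1, h2⟩ := emb_children h
  obtain ⟨d, hd, h3⟩ := h2 (starT (a + 1)) (by simp)
  rw [List.eq_of_mem_replicate hd] at h3
  have h4 := (emb_children h3).1
  simp at h1 h4
  omega

theorem litNode_not_emb {m j : ℕ} {js : List ℕ} (hj : j < m) (hjs : j ∈ js) :
    ¬ Emb (litNode m js) (zetaDel m (j + 1)) := by
  intro h
  obtain ⟨d, hd, h3⟩ := (emb_children h).2 (nu m (j + 1)) (List.mem_map.2 ⟨j, hjs, rfl⟩)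
  obtain ⟨k, hk, rfl⟩ := List.mem_map.1 hd
  simp at hk
  have := nu_inj hj hk.1 h3
  omega

theorem zetaDel_eq (m j : ℕ) :
    zetaDel m j = litNode m ((List.range m).filter (fun i => i + 1 != j)) := rfl

theorem zeta_eq (m : ℕ) : zeta m = litNode m (List.range m) := rfl

theorem litNode_mono {m : ℕ} {a b : List ℕ} (h : a.Sublist b) :
    Emb (litNode m a) (litNode m b) := emb_of_sublist (h.map _)

theorem emb_single_inv {a b : RTree} (h : Emb (node [a]) (node [b])) : Emb a b := by
  obtain ⟨d, hd, h⟩ := (emb_children h).2 a (by simp)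
  simp at hd
  exact hd ▸ h

theorem xiJ_not_emb {m n j k : ℕ} (hn : 0 < n) (hk : k < m) (hne : j ≠ k) :
    ¬ Emb (xiJ m n (j + 1)) (xiJ m n (k + 1)) := by
  intro h
  obtain ⟨d, hd, h⟩ := (emb_children h).2 (.node [zetaDel m (j + 1)]) (by simp; omega)
  rw [List.eq_of_mem_replicate hd] at h
  refine litNode_not_emb (js := (List.range m).filter (fun i => i + 1 != j + 1)) hk ?_
    (emb_single_inv h)
  simp; omega

theorem length_del (m j : ℕ) :
    m ≤ ((List.range m).filter (fun i => i + 1 != j + 1)).length + 1 := by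
  have e : ((List.range m).filter (fun i => i + 1 != j + 1)) = (List.range m).erase j := by
    rw [List.nodup_range.erase_eq_filter]
    apply List.filter_congr
    intro x _
    simp
  rw [e]
  have := List.length_erase_add_one (a := j) (l := List.range m)
  by_cases hj : j ∈ List.range m
  · have := this hj
    simp at this
    omega
  · rw [List.erase_of_not_mem hj]; simp

theorem xiJ_not_emb_gamma {n j : ℕ} {cs : List Clause} (hn : 0 < n) (hm : 10 < cs.length)
    (h4 : ∀ i b, (litClauses cs i b).length ≤ 4) :
    ¬ Emb (xiJ cs.length n (j + 1)) (gammaT n cs) := by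
  intro h
  obtain ⟨d, hd, h⟩ := (emb_children h).2 (.node [zetaDel cs.length (j + 1)]) (by simp; omega)
  obtain ⟨i, hi, rfl⟩ := List.mem_map.1 hd
  obtain ⟨e, he, h⟩ := (emb_children h).2 (zetaDel cs.length (j + 1)) (by simp)
  have key : ∀ b, ¬ Emb (zetaDel cs.length (j + 1)) (litNode cs.length (litClauses cs (i + 1) b)) := by
    intro b hb
    have h1 := (emb_children hb).1
    have h2 := h4 (i + 1) b
    have h3 := length_del cs.length j
    rw [List.length_map, List.length_map] at h1
    omega
  simp at he
  rcases he with rfl | rfl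
  · exact key _ h
  · exact key _ h

theorem gammaA_emb_gammaT (n : ℕ) (cs : List Clause) (α : ℕ → Bool) :
    Emb (gammaA n cs α) (gammaT n cs) := by
  refine emb_of_forall₂ ?_
  rw [List.forall₂_iff_get]
  refine ⟨by simp, ?_⟩
  intro i h1 h2
  simp only [List.get_eq_getElem, List.getElem_map, List.getElem_range]
  refine emb_of_sublist ?_
  split <;> simp

theorem gammaA_emb_xiT (n : ℕ) (cs : List Clause) (α : ℕ → Bool) :
    Emb (gammaA n cs α) (xiT cs.length n) := by
  refine emb_of_forall₂ ?_
  rw [List.forall₂_iff_get]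
  refine ⟨by simp, ?_⟩
  intro i h1 h2
  simp only [List.get_eq_getElem, List.getElem_map, List.getElem_range, List.getElem_replicate]
  refine emb_single ?_
  split <;> exact litNode_mono List.filter_sublist

theorem gammaA_not_emb_xiJ {n j : ℕ} {cs : List Clause} {α : ℕ → Bool} (hcnf : IsCNF34 n cs)
    (hs : Sat α cs) (hj : j < cs.length) :
    ¬ Emb (gammaA n cs (fun i => !α i)) (xiJ cs.length n (j + 1)) := by
  intro h
  obtain ⟨⟨i, b⟩, hl, hb⟩ := hs cs[j] (List.getElem_mem hj)
  obtain ⟨h1, h2⟩ := (hcnf.1 cs[j] (List.getElem_mem hj)).1 _ hl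
  simp only at hb h1 h2
  obtain ⟨d, hd, h⟩ := (emb_children h).2 (muA cs (fun i => !α i) i)
    (List.mem_map.2 ⟨i - 1, by simp; omega, by rw [Nat.sub_add_cancel h1]⟩)
  rw [List.eq_of_mem_replicate hd] at h
  have h := emb_single_inv h
  have hmem : j ∈ litClauses cs i b := by
    simp [litClauses, hj, hl]
  cases b <;> simp only [hb] at h <;> exact litNode_not_emb hj hmem (by simpa using h)

theorem support_eq (n : ℕ) (cs : List Clause) (T : RTree) :
    support (TFam n cs) T = support {xiT cs.length n} T + (support {gammaT n cs} T +
      support (((List.range cs.length).map (fun j => xiJ cs.length n (j + 1)) : List RTree)) T) := by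
  classical
  unfold support TFam
  rw [← Multiset.card_add, ← Multiset.card_add, ← Multiset.filter_add, ← Multiset.filter_add]
  rfl

theorem support_pos {𝒯 : Multiset RTree} {R T : RTree} (hR : R ∈ 𝒯) (h : Emb T R) :
    1 ≤ support 𝒯 T := by
  classical
  unfold support
  exact Multiset.card_pos_iff_exists_mem.2 ⟨R, Multiset.mem_filter.2 ⟨hR, h⟩⟩

theorem support_zero {𝒯 : Multiset RTree} {T : RTree} (h : ∀ R ∈ 𝒯, ¬ Emb T R) :
    support 𝒯 T = 0 := by
  classical
  unfold support
  rw [Multiset.card_eq_zero, Multiset.filter_eq_nil]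
  exact h

theorem support_single (R T : RTree) : support {R} T ≤ 1 := by
  classical
  unfold support
  exact (Multiset.card_le_card (Multiset.filter_le _ _)).trans (by simp)

theorem xiJ_max {n j : ℕ} {cs : List Clause} (hn : 0 < n) (hm : 10 < cs.length)
    (hcnf : IsCNF34 n cs) (hj : j < cs.length) :
    MaxFrequent (TFam n cs) 2 (xiJ cs.length n (j + 1)) := by
  constructor
  · rw [support_eq]
    have h1 := support_pos (Multiset.mem_singleton_self _) (xiJ_emb_xiT cs.length n (j + 1))
    have h2 := support_pos (𝒯 := (((List.range cs.length).map
      (fun j => xiJ cs.length n (j + 1)) : List RTree)))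
      (Multiset.mem_coe.2 (List.mem_map.2 ⟨j, by simpa using hj, rfl⟩))
      (Emb.refl' (xiJ cs.length n (j + 1)))
    omega
  · intro T' hT h
    refine ⟨h, ?_⟩
    by_contra hno
    rw [support_eq] at hT
    have h1 := support_single (xiT cs.length n) T'
    have h2 : support {gammaT n cs} T' = 0 := support_zero (by
      intro R hR he
      rw [Multiset.mem_singleton.1 hR] at he
      exact xiJ_not_emb_gamma hn hm hcnf.2 (h.trans' he))
    have h3 : support (((List.range cs.length).map
        (fun j => xiJ cs.length n (j + 1)) : List RTree)) T' = 0 := support_zero (by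
      intro R hR he
      obtain ⟨k, hk, rfl⟩ := List.mem_map.1 (Multiset.mem_coe.1 hR)
      by_cases hjk : j = k
      · subst hjk; exact hno he
      · exact xiJ_not_emb hn (by simpa using hk) hjk (h.trans' he))
    omega

theorem exists_max {𝒯 : Multiset RTree} {T : RTree} (hT : 2 ≤ support 𝒯 T) :
    ∃ M, Emb T M ∧ MaxFrequent 𝒯 2 M := by
  classical
  have hbound : ∀ M, 2 ≤ support 𝒯 M → numV M ≤ (𝒯.map numV).sum := by
    intro M hM
    have : 0 < (𝒯.filter (fun R => Emb M R)).card := by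
      unfold support at hM
      convert Nat.lt_of_lt_of_le Nat.zero_lt_two hM
    obtain ⟨R, hR⟩ := Multiset.card_pos_iff_exists_mem.1 this
    obtain ⟨h1, h2⟩ := Multiset.mem_filter.1 hR
    exact (emb_numV h2).1.trans (Multiset.single_le_sum (by simp) _ (Multiset.mem_map_of_mem _ h1))
  let P : ℕ → Prop := fun k => ∃ M, Emb T M ∧ 2 ≤ support 𝒯 M ∧ numV M = k
  have hP : P (numV T) := ⟨T, Emb.refl' T, hT, rfl⟩
  have hle : numV T ≤ (𝒯.map numV).sum := hbound T hT
  obtain ⟨M, h1, h2, h3⟩ := Nat.findGreatest_spec (P := P) hle hP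
  refine ⟨M, h1, h2, fun T' hT' he => ⟨he, (emb_numV he).2 ?_⟩⟩
  apply le_antisymm (emb_numV he).1
  rw [h3]
  exact Nat.le_findGreatest (hbound T' hT') ⟨T', h1.trans' he, hT', rfl⟩

end RTree

open RTree in
/-- Let `φ` be a (3,4)-CNF formula with `m > 10` clauses and `n > 10` variables.  If
`φ` is satisfiable, then `𝒯_φ = {ξ, ξ₁, …, ξ_m, Γ_φ}` has at least `m + 1` pairwise
non-isomorphic maximal `2`-frequent trees. -/
theorem sat_implies_many_maxFrequent (n : ℕ) (cs : List Clause)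
    (hn : 10 < n) (hm : 10 < cs.length) (hcnf : IsCNF34 n cs)
    (hsat : ∃ α : ℕ → Bool, Sat α cs) :
    ∃ L : List RTree, L.length = cs.length + 1 ∧
      (∀ T ∈ L, MaxFrequent (TFam n cs) 2 T) ∧
      L.Pairwise (fun T₁ T₂ => ¬ Iso T₁ T₂) := by
  obtain ⟨α, hs⟩ := hsat
  have hfreq : 2 ≤ support (TFam n cs) (gammaA n cs (fun i => !α i)) := by
    rw [support_eq]
    have h1 := support_pos (Multiset.mem_singleton_self _)
      (gammaA_emb_xiT n cs (fun i => !α i))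
    have h2 := support_pos (Multiset.mem_singleton_self _)
      (gammaA_emb_gammaT n cs (fun i => !α i))
    omega
  obtain ⟨M, hM1, hM2⟩ := exists_max hfreq
  refine ⟨M :: (List.range cs.length).map (fun j => xiJ cs.length n (j + 1)), by simp, ?_, ?_⟩
  · intro T hT
    rcases List.mem_cons.1 hT with rfl | hT
    · exact hM2
    · obtain ⟨j, hj, rfl⟩ := List.mem_map.1 hT
      exact xiJ_max (by omega) hm hcnf (by simpa using hj)
  · refine List.pairwise_cons.2 ⟨?_, ?_⟩
    · intro T hT hI
      obtain ⟨j, hj, rfl⟩ := List.mem_map.1 hT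
      exact gammaA_not_emb_xiJ hcnf hs (by simpa using hj) (hM1.trans' hI.1)
    · rw [List.pairwise_map]
      refine (List.nodup_range.pairwise_of_forall_ne ?_)
      intro a ha b hb hab hI
      exact xiJ_not_emb (by omega) (by simpa using hb) hab hI.1
end
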